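/- Fix a real number p ≥ 2 and an integer n ≥ 1, and let φ_n be as defined in the context. Then r²·φ_n''(r) ≤ p(p-1)·φ_n(r) for every r ∈ ℝ. -/

import Mathlib

/-- The truncated power function `φ_n`: `φ_n(r) = |r|^p` for `|r| < n`, and the second-order
Taylor extension `n^{p-2} (p(p-1)/2)(|r|-n)² + p n^{p-1}(|r|-n) + n^p` for `|r| ≥ n`. -/
noncomputable def phi (p : ℝ) (n : ℕ) (r : ℝ) : ℝ :=
  if |r| < n then |r| ^ p
  else (n : ℝ) ^ (p - 2) * (p * (p - 1) / 2) * (|r| - n) ^ 2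
      + p * (n : ℝ) ^ (p - 1) * (|r| - n) + (n : ℝ) ^ p

/-- Two differentiable functions whose values and derivatives agree at `a` glue to a
differentiable function. -/
theorem hasDerivAt_ite_lt {u v u' v' : ℝ → ℝ} {a x : ℝ}
    (hu : x ≤ a → HasDerivAt u (u' x) x) (hv : a ≤ x → HasDerivAt v (v' x) x)
    (h0 : u a = v a) (h1 : u' a = v' a) :
    HasDerivAt (fun y => if y < a then u y else v y) (if x < a then u' x else v' x) x := by
  rcases lt_trichotomy x a with h | rfl | h
  · rw [if_pos h]
    refine (hu h.le).congr_of_eventuallyEq ?_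
    filter_upwards [eventually_lt_nhds h] with y hy
    rw [if_pos hy]
  · rw [if_neg (lt_irrefl x), ← hasDerivWithinAt_univ, ← Set.Iic_union_Ici (a := x)]
    refine HasDerivWithinAt.union ?_ ?_
    · rw [← h1]
      refine (hu le_rfl).hasDerivWithinAt.congr_of_mem (fun y hy => ?_) Set.self_mem_Iic
      rcases lt_or_eq_of_le (Set.mem_Iic.1 hy) with hy | rfl
      · rw [if_pos hy]
      · rw [if_neg (lt_irrefl y), h0]
    · refine (hv le_rfl).hasDerivWithinAt.congr_of_mem (fun y hy => ?_) Set.self_mem_Ici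
      rw [if_neg (not_lt.2 (Set.mem_Ici.1 hy))]
  · rw [if_neg h.not_gt]
    refine (hv h.le).congr_of_eventuallyEq ?_
    filter_upwards [eventually_gt_nhds h] with y hy
    rw [if_neg hy.not_gt]

theorem phi_neg (p : ℝ) (n : ℕ) (r : ℝ) : phi p n (-r) = phi p n r := by
  simp only [phi, abs_neg]

theorem phi_nonneg {p : ℝ} (hp : 2 ≤ p) (n : ℕ) (r : ℝ) : 0 ≤ phi p n r := by
  unfold phi
  split_ifs with h
  · positivity
  · have h1 : 0 ≤ |r| - n := by linarith
    have h2 : 0 ≤ p - 1 := by linarith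
    have h3 : 0 ≤ p := by linarith
    positivity

theorem deriv_deriv_phi_neg (p : ℝ) (n : ℕ) (r : ℝ) :
    deriv (deriv (phi p n)) (-r) = deriv (deriv (phi p n)) r := by
  have h : deriv (phi p n) = fun x => -deriv (phi p n) (-x) := by
    ext x
    rw [← deriv_comp_neg]
    simp only [phi_neg]
  conv_rhs => rw [h]
  rw [deriv.fun_neg, deriv_comp_neg, neg_neg]

theorem hasDerivAt_phi (p : ℝ) (n : ℕ) {x : ℝ} (hx : 0 < x) :
    HasDerivAt (phi p n) (if x < n then p * x ^ (p - 1)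
      else (n : ℝ) ^ (p - 2) * (p * (p - 1)) * (x - n) + p * (n : ℝ) ^ (p - 1)) x := by
  have key := hasDerivAt_ite_lt (a := (n : ℝ)) (x := x) (u := fun y => y ^ p)
    (v := fun y => (n : ℝ) ^ (p - 2) * (p * (p - 1) / 2) * (y - n) ^ 2
      + p * (n : ℝ) ^ (p - 1) * (y - n) + (n : ℝ) ^ p)
    (u' := fun y => p * y ^ (p - 1))
    (v' := fun y => (n : ℝ) ^ (p - 2) * (p * (p - 1)) * (y - n) + p * (n : ℝ) ^ (p - 1))
    (fun _ => Real.hasDerivAt_rpow_const (Or.inl hx.ne'))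
    (fun _ => by
      have h := (hasDerivAt_id x).sub_const (n : ℝ)
      refine ((((h.pow 2).const_mul ((n : ℝ) ^ (p - 2) * (p * (p - 1) / 2))).add
        (h.const_mul (p * (n : ℝ) ^ (p - 1)))).add_const ((n : ℝ) ^ p)).congr_deriv ?_
      simp only [id]
      push_cast
      ring)
    (by simp) (by simp)
  refine key.congr_of_eventuallyEq ?_
  filter_upwards [eventually_gt_nhds hx] with y hy
  simp only [phi, abs_of_pos hy]

theorem deriv_deriv_phi (p : ℝ) (n : ℕ) {x : ℝ} (hx : 0 < x) :
    deriv (deriv (phi p n)) x = if x < n then p * (p - 1) * x ^ (p - 2)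
      else p * (p - 1) * (n : ℝ) ^ (p - 2) := by
  have key := hasDerivAt_ite_lt (a := (n : ℝ)) (x := x) (u := fun y => p * y ^ (p - 1))
    (v := fun y => (n : ℝ) ^ (p - 2) * (p * (p - 1)) * (y - n) + p * (n : ℝ) ^ (p - 1))
    (u' := fun y => p * (p - 1) * y ^ (p - 2))
    (v' := fun _ => p * (p - 1) * (n : ℝ) ^ (p - 2))
    (fun _ => by
      refine ((Real.hasDerivAt_rpow_const (p := p - 1) (Or.inl hx.ne')).const_mul p).congr_deriv ?_
      rw [show p - 1 - 1 = p - 2 by ring]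
      ring)
    (fun _ => by
      refine ((((hasDerivAt_id x).sub_const (n : ℝ)).const_mul
        ((n : ℝ) ^ (p - 2) * (p * (p - 1)))).add_const (p * (n : ℝ) ^ (p - 1))).congr_deriv ?_
      ring)
    (by simp) rfl
  refine (key.congr_of_eventuallyEq ?_).deriv
  filter_upwards [eventually_gt_nhds hx] with y hy
  exact (hasDerivAt_phi p n hy).deriv

theorem sq_mul_deriv_deriv_phi_le_of_pos {p : ℝ} (hp : 2 ≤ p) {n : ℕ} (hn : 1 ≤ n) {r : ℝ}
    (hr : 0 < r) : r ^ 2 * deriv (deriv (phi p n)) r ≤ p * (p - 1) * phi p n r := by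
  rw [deriv_deriv_phi p n hr, phi, abs_of_pos hr]
  have hpp : 0 ≤ p * (p - 1) := mul_nonneg (by linarith) (by linarith)
  have hpow : ∀ x : ℝ, 0 < x → x ^ p = x ^ (p - 2) * x ^ 2 := fun x hx => by
    rw [← Real.rpow_natCast x 2, ← Real.rpow_add hx]
    norm_num
  split_ifs with h
  · rw [hpow r hr]
    exact le_of_eq (by ring)
  · have hn0 : (0 : ℝ) < n := by exact_mod_cast hn
    have hpow1 : (n : ℝ) ^ (p - 1) = (n : ℝ) ^ (p - 2) * n := by
      rw [← Real.rpow_add_one hn0.ne']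
      ring_nf
    rw [hpow n hn0, hpow1]
    have ht : 0 ≤ r - n := by linarith
    have hc : 0 ≤ (n : ℝ) ^ (p - 2) := by positivity
    have hquad : r ^ 2 ≤ p * (p - 1) / 2 * (r - n) ^ 2 + p * n * (r - n) + n ^ 2 := by
      have h1 : 0 ≤ (p * (p - 1) / 2 - 1) * (r - n) ^ 2 :=
        mul_nonneg (by nlinarith) (sq_nonneg _)
      have h2 : 0 ≤ (p - 2) * (n * (r - n)) :=
        mul_nonneg (by linarith) (mul_nonneg hn0.le ht)
      nlinarith
    have := mul_le_mul_of_nonneg_left hquad (mul_nonneg hpp hc)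
    linarith

/-- For `p ≥ 2` and `n ≥ 1`, `r² φ_n''(r) ≤ p(p-1) φ_n(r)` for every `r ∈ ℝ`. -/
theorem statement10 (p : ℝ) (hp : 2 ≤ p) (n : ℕ) (hn : 1 ≤ n) (r : ℝ) :
    r ^ 2 * deriv (deriv (phi p n)) r ≤ p * (p - 1) * phi p n r := by
  rcases lt_trichotomy r 0 with hr | rfl | hr
  · have h := sq_mul_deriv_deriv_phi_le_of_pos hp hn (neg_pos.2 hr)
    rwa [neg_sq, deriv_deriv_phi_neg, phi_neg] at h
  · rw [zero_pow two_ne_zero, zero_mul]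
    exact mul_nonneg (mul_nonneg (by linarith) (by linarith)) (phi_nonneg hp n 0)
  · exact sq_mul_deriv_deriv_phi_le_of_pos hp hn hr
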